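/- Let (Ω, F, P) be a probability space and suppose that for almost every ω ∈ Ω there is a switched trajectory setup with random switching times t₀ < t₁(ω) < t₂(ω) < ⋯ → ∞, random modes i_k(ω) in a fixed finite set 𝕊, and a continuous trajectory x(ω,·) : [t₀,∞) → ℝⁿ, with fixed continuous λ_i and constants μ_i ≥ 1, for which the Lyapunov conditions (ii) and (iii) hold pathwise. Assume there are constants c > 0, p > 0, C > 0 and κ < 0 such that almost surely: c·‖x(ω,t)‖^p ≤ V_{σ_ω(t)}(t, x(ω,t)) for all t ≥ t₀; 0 < V_{i₀(ω)}(t₀, x(ω,t₀)) ≤ C; and limsup_{t→∞} g_ω(t)/t ≤ κ, where g_ω is the drift functional of the path ω. Then P[ limsup_{t→∞} (1/t)·ln‖x(t)‖ ≤ κ/p ] = 1; in particular, limsup_{t→∞} (1/t)·ln‖x(t)‖ < 0 almost surely, i.e. the randomly switched system is almost surely globally exponentially stable. -/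

import Mathlib

open Set Filter MeasureTheory

lemma aux_gron (f l : ℝ → ℝ) (a b : ℝ) (hl : Continuous l)
    (hf : ContinuousOn f (Icc a b)) (hd : DifferentiableOn ℝ f (Ioo a b))
    (hder : ∀ s ∈ Ioo a b, deriv f s ≤ l s * f s) (s : ℝ) (hs : s ∈ Icc a b) :
    f s ≤ f a * Real.exp (∫ h in a..s, l h) := by
  have hI : ∀ u, HasDerivAt (fun u => ∫ h in a..u, l h) (l u) u := fun u =>
    intervalIntegral.integral_hasDerivAt_right (hl.intervalIntegrable _ _)
      hl.aestronglyMeasurable.stronglyMeasurableAtFilter hl.continuousAt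
  have hE : ∀ u, HasDerivAt (fun u => Real.exp (-∫ h in a..u, l h))
      (Real.exp (-∫ h in a..u, l h) * (-l u)) u := fun u => (hI u).neg.exp
  have hD : ∀ u ∈ Ioo a b, HasDerivAt (fun u => f u * Real.exp (-∫ h in a..u, l h))
      (deriv f u * Real.exp (-∫ h in a..u, l h)
        + f u * (Real.exp (-∫ h in a..u, l h) * (-l u))) u := fun u hu =>
    ((hd.differentiableAt (Ioo_mem_nhds hu.1 hu.2)).hasDerivAt).mul (hE u)
  have hanti : AntitoneOn (fun u => f u * Real.exp (-∫ h in a..u, l h)) (Icc a b) := by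
    apply antitoneOn_of_deriv_nonpos (convex_Icc a b)
    · exact hf.mul (fun u _ => (hE u).continuousAt.continuousWithinAt)
    · rw [interior_Icc]
      exact fun u hu => (hD u hu).differentiableAt.differentiableWithinAt
    · rw [interior_Icc]
      intro u hu
      rw [(hD u hu).deriv]
      have := hder u hu
      have h2 := Real.exp_pos (-∫ h in a..u, l h)
      nlinarith
  have h := hanti (left_mem_Icc.2 (hs.1.trans hs.2)) hs hs.1
  simp only [intervalIntegral.integral_same, neg_zero, Real.exp_zero, mul_one] at h
  have h3 := mul_le_mul_of_nonneg_right h (Real.exp_pos (∫ h in a..s, l h)).le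
  rwa [mul_assoc, ← Real.exp_add, neg_add_cancel, Real.exp_zero, mul_one] at h3

lemma aux_int (F l : ℝ → ℝ) (a b s : ℝ) (hl : Continuous l)
    (hF : ∀ u ∈ Ico a b, F u = l u) (hs : s ∈ Icc a b) :
    IntervalIntegrable F volume a s ∧ ∫ h in a..s, F h = ∫ h in a..s, l h := by
  have hae : ∀ᵐ u ∂(volume : Measure ℝ), u ∈ uIoc a s → F u = l u := by
    have : ∀ᵐ u ∂(volume : Measure ℝ), u ≠ b := by
      simp [ae_iff]
    filter_upwards [this] with u hu hm
    rw [uIoc_of_le hs.1] at hm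
    exact hF u ⟨hm.1.le, lt_of_le_of_ne (hm.2.trans hs.2) hu⟩
  refine ⟨?_, intervalIntegral.integral_congr_ae hae⟩
  refine (hl.intervalIntegrable a s).congr_ae ?_
  rw [EventuallyEq, ae_restrict_iff' measurableSet_uIoc]
  filter_upwards [hae] with u hu hm using (hu hm).symm

lemma aux_path {𝕊 E : Type*} (t₀ : ℝ) (t : ℕ → ℝ) (idx : ℕ → 𝕊) (h0 : t 0 = t₀)
    (hm : StrictMono t) (σ : ℝ → 𝕊)
    (hσ : ∀ k, ∀ s ∈ Ico (t k) (t (k + 1)), σ s = idx k) (x : ℝ → E)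
    (lam : 𝕊 → ℝ → ℝ) (hlam : ∀ i, Continuous (lam i))
    (μ : 𝕊 → ℝ) (hμ : ∀ i, 1 ≤ μ i) (V : 𝕊 → ℝ → E → ℝ)
    (hc : ∀ k, ContinuousOn (fun s => V (idx k) s (x s)) (Icc (t k) (t (k + 1))))
    (hd : ∀ k, DifferentiableOn ℝ (fun s => V (idx k) s (x s)) (Ioo (t k) (t (k + 1))))
    (hder : ∀ k, ∀ s ∈ Ioo (t k) (t (k + 1)),
      deriv (fun s' => V (idx k) s' (x s')) s ≤ lam (idx k) s * V (idx k) s (x s))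
    (hj : ∀ k, V (idx (k + 1)) (t (k + 1)) (x (t (k + 1))) ≤
      μ (idx (k + 1)) * V (idx k) (t (k + 1)) (x (t (k + 1)))) (k : ℕ) :
    ∀ s ∈ Icc (t k) (t (k + 1)), IntervalIntegrable (fun h => lam (σ h) h) volume t₀ s ∧
      V (idx k) s (x s) ≤ V (idx 0) t₀ (x t₀) *
        Real.exp ((∫ h in t₀..s, lam (σ h) h) + ∑ l ∈ Finset.Icc 1 k, Real.log (μ (idx l))) := by
  have key : ∀ k, IntervalIntegrable (fun h => lam (σ h) h) volume t₀ (t k) →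
      V (idx k) (t k) (x (t k)) ≤ V (idx 0) t₀ (x t₀) *
        Real.exp ((∫ h in t₀..(t k), lam (σ h) h)
          + ∑ l ∈ Finset.Icc 1 k, Real.log (μ (idx l))) →
      ∀ s ∈ Icc (t k) (t (k + 1)), IntervalIntegrable (fun h => lam (σ h) h) volume t₀ s ∧
      V (idx k) s (x s) ≤ V (idx 0) t₀ (x t₀) *
        Real.exp ((∫ h in t₀..s, lam (σ h) h)
          + ∑ l ∈ Finset.Icc 1 k, Real.log (μ (idx l))) := by
    intro k hi hv s hs
    obtain ⟨h1, h2⟩ := aux_int (fun h => lam (σ h) h) (lam (idx k)) (t k) (t (k + 1)) s (hlam _)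
      (fun u hu => by simp only [hσ k u hu]) hs
    refine ⟨hi.trans h1, ?_⟩
    have h3 := aux_gron _ _ _ _ (hlam (idx k)) (hc k) (hd k) (hder k) s hs
    refine h3.trans ((mul_le_mul_of_nonneg_right hv (Real.exp_pos _).le).trans (le_of_eq ?_))
    rw [mul_assoc, ← Real.exp_add, ← intervalIntegral.integral_add_adjacent_intervals hi h1, h2]
    congr 2
    ring
  induction k with
  | zero =>
    apply key
    · rw [h0]
    · simp [h0]
  | succ k ih =>
    obtain ⟨h1, h2⟩ := ih (t (k + 1)) (right_mem_Icc.2 (hm (Nat.lt_succ_self k)).le)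
    refine key _ h1 ?_
    have hpos : 0 < μ (idx (k + 1)) := lt_of_lt_of_le one_pos (hμ _)
    refine (hj k).trans ((mul_le_mul_of_nonneg_left h2 hpos.le).trans (le_of_eq ?_))
    rw [Finset.sum_Icc_succ_top (by omega), ← add_assoc, Real.exp_add _ (Real.log _),
      Real.exp_log hpos]
    ring

lemma aux_find (t : ℕ → ℝ) (ht : Tendsto t atTop atTop) (s : ℝ) (hs : t 0 ≤ s) :
    ∃ k, s ∈ Ico (t k) (t (k + 1)) := by
  by_contra! hcon
  have : ∀ k, t k ≤ s := by
    intro k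
    induction k with
    | zero => exact hs
    | succ k ih =>
      by_contra! h
      exact hcon k ⟨ih, h⟩
  obtain ⟨k, hk⟩ := (ht.eventually_gt_atTop s).exists
  exact absurd (this k) (not_le.2 hk)

/-- Almost-sure global exponential stability for randomly switched time-varying systems,
stated conditionally on the ergodic drift estimate: if almost surely the drift functional
satisfies `limsup g_ω(t)/t ≤ κ < 0` (in ε-form), then almost surely
`limsup (1/t) ln ‖x t‖ ≤ κ/p < 0` (in ε-form, ignoring times where `x t = 0`). -/
theorem stmt_12 {Ω : Type*} [MeasurableSpace Ω] (P : Measure Ω) [IsProbabilityMeasure P]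
    {𝕊 : Type*} [Fintype 𝕊] (n : ℕ) (t₀ : ℝ)
    -- random switching times and modes
    (tms : Ω → ℕ → ℝ) (idx : Ω → ℕ → 𝕊)
    (htms : ∀ᵐ ω ∂P, tms ω 0 = t₀ ∧ StrictMono (tms ω) ∧
      Filter.Tendsto (tms ω) Filter.atTop Filter.atTop)
    -- random switching signal
    (σf : Ω → ℝ → 𝕊)
    (hσ : ∀ᵐ ω ∂P, ∀ k, ∀ s ∈ Set.Ico (tms ω k) (tms ω (k + 1)), σf ω s = idx ω k)
    -- random trajectory
    (x : Ω → ℝ → EuclideanSpace ℝ (Fin n))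
    (hx_cont : ∀ᵐ ω ∂P, ContinuousOn (x ω) (Set.Ici t₀))
    -- fixed data
    (lam : 𝕊 → ℝ → ℝ) (hlam : ∀ i, Continuous (lam i))
    (μ : 𝕊 → ℝ) (hμ : ∀ i, 1 ≤ μ i)
    (V : 𝕊 → ℝ → EuclideanSpace ℝ (Fin n) → ℝ)
    -- pathwise Lyapunov condition (ii)
    (hV_cont : ∀ᵐ ω ∂P, ∀ k, ContinuousOn (fun s => V (idx ω k) s (x ω s))
      (Set.Icc (tms ω k) (tms ω (k + 1))))
    (hV_diff : ∀ᵐ ω ∂P, ∀ k, DifferentiableOn ℝ (fun s => V (idx ω k) s (x ω s))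
      (Set.Ioo (tms ω k) (tms ω (k + 1))))
    (hV_deriv : ∀ᵐ ω ∂P, ∀ k, ∀ s ∈ Set.Ioo (tms ω k) (tms ω (k + 1)),
      deriv (fun s' => V (idx ω k) s' (x ω s')) s ≤ lam (idx ω k) s * V (idx ω k) s (x ω s))
    -- pathwise Lyapunov condition (iii)
    (hjump : ∀ᵐ ω ∂P, ∀ k, V (idx ω (k + 1)) (tms ω (k + 1)) (x ω (tms ω (k + 1))) ≤
      μ (idx ω (k + 1)) * V (idx ω k) (tms ω (k + 1)) (x ω (tms ω (k + 1))))
    -- lower bound on the Lyapunov functions and bounds on the initial value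
    (c p C κ : ℝ) (hc : 0 < c) (hp : 0 < p) (hC : 0 < C) (hκ : κ < 0)
    (hlow : ∀ᵐ ω ∂P, ∀ s ≥ t₀, c * ‖x ω s‖ ^ p ≤ V (σf ω s) s (x ω s))
    (hV0 : ∀ᵐ ω ∂P, 0 < V (idx ω 0) t₀ (x ω t₀) ∧ V (idx ω 0) t₀ (x ω t₀) ≤ C)
    -- pathwise drift functional
    (g : Ω → ℝ → ℝ)
    (hg : ∀ᵐ ω ∂P, ∀ k, ∀ s ∈ Set.Ico (tms ω k) (tms ω (k + 1)),
      g ω s = (∫ h in t₀..s, lam (σf ω h) h) +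
        ∑ l ∈ Finset.Icc 1 k, Real.log (μ (idx ω l)))
    -- almost surely `limsup g_ω(t)/t ≤ κ` in ε-form
    (hglimsup : ∀ᵐ ω ∂P, ∀ ε > (0 : ℝ), ∀ᶠ s in Filter.atTop, g ω s / s ≤ κ + ε) :
    ∀ᵐ ω ∂P, ∀ ε > (0 : ℝ), ∀ᶠ s in Filter.atTop,
      x ω s ≠ 0 → Real.log ‖x ω s‖ / s ≤ κ / p + ε := by
  filter_upwards [htms, hσ, hV_cont, hV_diff, hV_deriv, hjump, hlow, hV0, hg, hglimsup] with
    ω ⟨h0, hm, ht⟩ hσ hVc hVd hVder hj hlow hV0 hg hlim ε hε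
  have hlim0 : Tendsto (fun s : ℝ => (Real.log C - Real.log c) / s) atTop (nhds 0) :=
    tendsto_const_nhds.div_atTop tendsto_id
  filter_upwards [hlim (p * ε / 2) (by positivity), eventually_ge_atTop t₀, eventually_gt_atTop 0,
    hlim0.eventually_le_const (show (0 : ℝ) < p * ε / 2 by positivity)] with s hgs hs hs0 hCs hx
  obtain ⟨k, hk⟩ := aux_find (tms ω) ht s (h0 ▸ hs)
  have h1 := (aux_path t₀ (tms ω) (idx ω) h0 hm (σf ω) hσ (x ω) lam hlam μ hμ V hVc hVd hVder hj k
    s (Ico_subset_Icc_self hk)).2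
  rw [← hg k s hk, ← hσ k s hk] at h1
  have hnx : 0 < ‖x ω s‖ := norm_pos_iff.2 hx
  have h2 : c * ‖x ω s‖ ^ p ≤ C * Real.exp (g ω s) :=
    (hlow s hs).trans (h1.trans (mul_le_mul_of_nonneg_right hV0.2 (Real.exp_pos _).le))
  have hxp : 0 < ‖x ω s‖ ^ p := Real.rpow_pos_of_pos hnx p
  have h3 := Real.log_le_log (mul_pos hc hxp) h2
  rw [Real.log_mul hc.ne' hxp.ne', Real.log_mul hC.ne' (Real.exp_pos _).ne', Real.log_exp,
    Real.log_rpow hnx] at h3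
  rw [div_le_iff₀ hs0] at hgs hCs ⊢
  have h4 : p * Real.log ‖x ω s‖ ≤ p * ((κ / p + ε) * s) := by
    have : p * ((κ / p + ε) * s) = (κ + p * ε) * s := by field_simp
    rw [this]
    linarith
  exact le_of_mul_le_mul_left h4 hp
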